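/- The real 4-dimensional 3-step nilpotent (filiform) Lie algebra with basis e_1, e_2, e_3, e_4 and nonzero brackets [e_1, e_2] = e_3, [e_1, e_3] = e_4 admits no complex structure: there is no linear endomorphism J of this Lie algebra with J∘J = −id whose Nijenhuis tensor vanishes. -/

import Mathlib

/-- A Lie algebra structure on `ℝ^n`: a bilinear, alternating bracket satisfying the
Jacobi identity. -/
structure LieStruct (n : ℕ) where
  bracket : (Fin n → ℝ) → (Fin n → ℝ) → (Fin n → ℝ)
  add_left : ∀ x y z, bracket (x + y) z = bracket x z + bracket y z
  add_right : ∀ x y z, bracket x (y + z) = bracket x y + bracket x z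
  smul_left : ∀ (c : ℝ) x y, bracket (c • x) y = c • bracket x y
  smul_right : ∀ (c : ℝ) x y, bracket x (c • y) = c • bracket x y
  alt : ∀ x, bracket x x = 0
  jacobi : ∀ x y z,
    bracket x (bracket y z) + bracket y (bracket z x) + bracket z (bracket x y) = 0

/-- The lower central series of a Lie algebra structure: `C⁰ = g`,
`Cᵏ⁺¹ = [g, Cᵏ]`. -/
def lcs {n : ℕ} (L : LieStruct n) : ℕ → Submodule ℝ (Fin n → ℝ)
  | 0 => ⊤
  | k + 1 => Submodule.span ℝ {z | ∃ x y, y ∈ lcs L k ∧ z = L.bracket x y}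

/-- A Lie algebra is nilpotent if its lower central series terminates at zero. -/
def LieStruct.IsNilpotent {n : ℕ} (L : LieStruct n) : Prop := ∃ k, lcs L k = ⊥

/-- Two Lie algebra structures are isomorphic if some linear bijection intertwines the
brackets. -/
def LieStruct.Iso {n : ℕ} (L L' : LieStruct n) : Prop :=
  ∃ f : (Fin n → ℝ) ≃ₗ[ℝ] (Fin n → ℝ), ∀ x y, f (L.bracket x y) = L'.bracket (f x) (f y)

/-- A complex structure on a Lie algebra: a linear `J` with `J² = −id` and vanishing
Nijenhuis tensor. -/
def LieStruct.AdmitsComplex {n : ℕ} (L : LieStruct n) : Prop :=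
  ∃ J : (Fin n → ℝ) →ₗ[ℝ] (Fin n → ℝ),
    (∀ x, J (J x) = -x) ∧
    (∀ x y, L.bracket (J x) (J y) - L.bracket x y
      - J (L.bracket (J x) y) - J (L.bracket x (J y)) = 0)

/-- A symplectic structure on a Lie algebra: a nondegenerate alternating bilinear form
satisfying the closedness (2-cocycle) condition. -/
def LieStruct.AdmitsSymplectic {n : ℕ} (L : LieStruct n) : Prop :=
  ∃ ω : (Fin n → ℝ) →ₗ[ℝ] (Fin n → ℝ) →ₗ[ℝ] ℝ,
    (∀ x, ω x x = 0) ∧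
    (∀ x, (∀ y, ω x y = 0) → x = 0) ∧
    (∀ x y z, ω (L.bracket x y) z + ω (L.bracket y z) x + ω (L.bracket z x) y = 0)

/-- Isomorphism of Lie algebra structures, restricted to those satisfying `P`. -/
def IsoOn {n : ℕ} (P : LieStruct n → Prop) :
    {L : LieStruct n // P L} → {L : LieStruct n // P L} → Prop :=
  fun L L' => L.1.Iso L'.1
/-- The filiform Lie algebra (3-step nilpotent): the nonzero brackets of basis vectors
are `[e₁, e₂] = e₃` and `[e₁, e₃] = e₄`. -/
def filiform4 : LieStruct 4 where
  bracket x y := ![0, 0, x 0 * y 1 - x 1 * y 0, x 0 * y 2 - x 2 * y 0]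
  add_left x y z := by funext i; fin_cases i <;> simp <;> ring
  add_right x y z := by funext i; fin_cases i <;> simp <;> ring
  smul_left c x y := by funext i; fin_cases i <;> simp <;> ring
  smul_right c x y := by funext i; fin_cases i <;> simp <;> ring
  alt x := by funext i; fin_cases i <;> simp <;> ring
  jacobi x y z := by funext i; fin_cases i <;> simp <;> ring

/-- The 4-dimensional 3-step nilpotent (filiform) Lie algebra admits no complex
structure. -/
theorem filiform_admits_no_complex_structure : ¬ filiform4.AdmitsComplex := by
  rintro ⟨J, hJ, hN⟩
  set e : Fin 4 → ℝ := ![0, 0, 0, 1] with he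
  -- brackets with the central element vanish
  have hc : ∀ y, filiform4.bracket e y = 0 := by
    intro y; funext i; fin_cases i <;> simp [filiform4, he]
  have hc' : ∀ y, filiform4.bracket y e = 0 := by
    intro y; funext i; fin_cases i <;> simp [filiform4, he]
  -- so `ad (J e)` commutes with `J`
  have key : ∀ y, filiform4.bracket (J e) (J y) = J (filiform4.bracket (J e) y) := by
    intro y
    have h := hN e y
    rw [hc, hc, map_zero, sub_zero, sub_zero] at h
    exact sub_eq_zero.mp h
  have ha : J e 0 = 0 := by
    have h := key ![0, 0, 1, 0]
    have h1 : filiform4.bracket (J e) ![0, 0, 1, 0] = (J e 0) • e := by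
      funext i; fin_cases i <;> simp [filiform4, he]
    rw [h1, map_smul] at h
    have h2 := congrFun h 0
    simp [filiform4] at h2
    exact h2
  have hbr : ∀ y, filiform4.bracket (J e) y
      = (y 0) • filiform4.bracket (J e) ![1, 0, 0, 0] := by
    intro y; funext i; fin_cases i <;> simp [filiform4, ha] <;> ring
  obtain ⟨v, hv⟩ : ∃ v, v = filiform4.bracket (J e) ![1, 0, 0, 0] := ⟨_, rfl⟩
  have h := key ![1, 0, 0, 0]
  rw [hbr (J _), ← hv] at h
  obtain ⟨p, hp⟩ : ∃ p, p = J ![1, 0, 0, 0] 0 := ⟨_, rfl⟩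
  rw [← hp] at h
  have hv0 : ∀ i, v i = 0 := by
    intro i
    have h3 := hJ v
    rw [← h, map_smul, ← h] at h3
    have h4 := congrFun h3 i
    simp only [Pi.smul_apply, Pi.neg_apply, smul_eq_mul] at h4
    have h5 : (p ^ 2 + 1) * v i = 0 := by linear_combination h4
    exact (mul_eq_zero.mp h5).resolve_left (by positivity)
  have hb : J e 1 = 0 := by
    have := hv0 2
    rw [hv] at this
    simpa [filiform4] using this
  have hcc : J e 2 = 0 := by
    have := hv0 3
    rw [hv] at this
    simpa [filiform4] using this
  have hd : J e = (J e 3) • e := by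
    funext i; fin_cases i <;> simp [he] <;> simpa [he] using by assumption
  obtain ⟨d, hd'⟩ : ∃ d, d = J e 3 := ⟨_, rfl⟩
  rw [← hd'] at hd
  have h6 := hJ e
  rw [hd, map_smul, hd] at h6
  have h7 := congrFun h6 3
  simp [he] at h7
  nlinarith [mul_self_nonneg d]
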